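/- (SLH floating 3-flo.) Let G be a simple graph on n ≥ 3 vertices and let L be a circle ordering of G written cyclically as L = X ++ Y ++ Z, where X = (x, …, c), Y = (a, …, b) and Z = (d, …, y) are nonempty segments. Suppose {y, x} is a gap of L, {x, a} is an edge of G, and at least one of {c, d} and {b, y} is an edge of G. Then the circle ordering L′ = Z ++ Y.reverse ++ X = (d, …, y, b, …, a, x, …, c) satisfies g(L′) ≤ g(L); if both {c, d} and {b, y} are edges of G, then g(L′) ≤ g(L) − 1. -/

import Mathlib

variable {V : Type*}

/-- The adjacent pairs of a circle ordering `L`: the unordered pairs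
`{vᵢ, vᵢ₊₁}` (indices mod `L.length`). -/
def adjPairs (L : List V) : List (Sym2 V) :=
  (L.zip (L.rotate 1)).map (fun p => s(p.1, p.2))

/-- `L` is a circle ordering of the vertex set `V`: a list containing every
vertex exactly once, regarded cyclically. -/
def IsCircleOrdering [Fintype V] (L : List V) : Prop :=
  L.Nodup ∧ ∀ v : V, v ∈ L

/-- `g(L)`: the number of gaps of `L`, i.e. adjacent pairs of `L` that are
not edges of `G`. -/
noncomputable def numGaps (G : SimpleGraph V) (L : List V) : ℕ :=
  (adjPairs L).countP (fun e => @decide (e ∉ G.edgeSet) (Classical.propDecidable _))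

/-- `dist(L, H) = n - (number of adjacent pairs of `L` lying in the edge set `H`)`. -/
noncomputable def distTo (H : Set (Sym2 V)) (L : List V) : ℕ :=
  L.length - (adjPairs L).countP (fun e => @decide (e ∈ H) (Classical.propDecidable _))

/-- `Δ(L, H) = g(L)/3 + dist(L, H)`. -/
noncomputable def delta (G : SimpleGraph V) (H : Set (Sym2 V)) (L : List V) : ℚ :=
  (numGaps G L : ℚ) / 3 + (distTo H L : ℚ)

/-- Two circle orderings are equivalent iff one is obtained from the other by a
cyclic rotation, a reversal of the order, or a composition of both. -/
def OrderEquiv (L M : List V) : Prop :=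
  (∃ k, M = L.rotate k) ∨ (∃ k, M = L.reverse.rotate k)

/-- A γ-move maps an ordering `A ++ B` (with `A`, `B` nonempty) to
`A.reverse ++ B`. -/
def GammaMove (L M : List V) : Prop :=
  ∃ A B : List V, A ≠ [] ∧ B ≠ [] ∧ L = A ++ B ∧ M = A.reverse ++ B

/-- A κ-move maps an ordering `A ++ B ++ C ++ D` (with `A`, `B`, `D` nonempty,
`C` possibly empty) to `A.reverse ++ B.reverse ++ D ++ C.reverse`. -/
def KappaMove (L M : List V) : Prop :=
  ∃ A B C D : List V, A ≠ [] ∧ B ≠ [] ∧ D ≠ [] ∧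
    L = A ++ B ++ C ++ D ∧ M = A.reverse ++ B.reverse ++ D ++ C.reverse

/-- A γ-move applied up to equivalence: the ordering may first be replaced by
any equivalent ordering. -/
def GammaStep (L M : List V) : Prop := ∃ L', OrderEquiv L L' ∧ GammaMove L' M

/-- A κ-move applied up to equivalence. -/
def KappaStep (L M : List V) : Prop := ∃ L', OrderEquiv L L' ∧ KappaMove L' M

/-- `M` is obtained from `L` by applying at most one κ-move and at most one
γ-move (in some order), each up to equivalence. -/
def KGStep (L M : List V) : Prop :=
  OrderEquiv L M ∨ GammaStep L M ∨ KappaStep L M ∨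
    (∃ K, KappaStep L K ∧ GammaStep K M) ∨
    (∃ K, GammaStep L K ∧ KappaStep K M)

/-- The consecutive unordered pairs of a list, without the wrap-around pair. -/
def pathPairs : List V → List (Sym2 V)
  | [] => []
  | [_] => []
  | u :: v :: l => s(u, v) :: pathPairs (v :: l)

theorem pathPairs_append {A B : List V} {u v : V} (hA : A.getLast? = some u)
    (hB : B.head? = some v) :
    pathPairs (A ++ B) = pathPairs A ++ s(u, v) :: pathPairs B := by
  induction A using pathPairs.induct with
  | case1 => simp at hA
  | case2 w =>
    cases B with
    | nil => simp at hB
    | cons z B =>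
      simp only [List.getLast?_singleton, Option.some.injEq] at hA
      simp only [List.head?_cons, Option.some.injEq] at hB
      subst hA hB
      simp [pathPairs]
  | case3 w z l ih =>
    rw [List.getLast?_cons_cons] at hA
    simpa [pathPairs] using ih hA

theorem pathPairs_reverse_perm (A : List V) : (pathPairs A.reverse).Perm (pathPairs A) := by
  induction A using pathPairs.induct with
  | case1 => simp [pathPairs]
  | case2 w => simp [pathPairs]
  | case3 u v l ih =>
    rw [List.reverse_cons,
      pathPairs_append (u := v) (v := u) (by simp) (by simp), Sym2.eq_swap]
    simp only [pathPairs]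
    exact (List.perm_append_singleton _ _).trans (ih.cons _)

theorem map_zip_append_singleton (l : List V) (w z : V) :
    ((w :: l).zip (l ++ [z])).map (fun p => s(p.1, p.2)) =
      pathPairs (w :: (l ++ [z])) := by
  induction l generalizing w with
  | nil => simp [pathPairs]
  | cons v l ih => simpa [pathPairs] using ih v

theorem adjPairs_eq_pathPairs_append {L : List V} {u v : V} (hu : L.head? = some u)
    (hv : L.getLast? = some v) : adjPairs L = pathPairs L ++ [s(v, u)] := by
  cases L with
  | nil => simp at hu
  | cons w l =>
    simp only [List.head?_cons, Option.some.injEq] at hu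
    subst hu
    have h := pathPairs_append (B := [w]) hv rfl
    rw [List.cons_append] at h
    simp only [pathPairs] at h
    rw [← h, ← map_zip_append_singleton]
    simp [adjPairs]

theorem adjPairs_append_three {X Y Z : List V} {x c a b d y : V}
    (hx : X.head? = some x) (hc : X.getLast? = some c)
    (ha : Y.head? = some a) (hb : Y.getLast? = some b)
    (hd : Z.head? = some d) (hy : Z.getLast? = some y) :
    adjPairs (X ++ Y ++ Z) =
      pathPairs X ++ s(c, a) :: pathPairs Y ++ s(b, d) :: pathPairs Z ++ [s(y, x)] := by
  rw [adjPairs_eq_pathPairs_append (u := x) (v := y) (by simp [hx]) (by simp [hy]),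
    pathPairs_append (u := b) (v := d) (by simp [hb]) hd, pathPairs_append hc ha]

/-- SLH floating 3-flo: if `{y,x}` is a gap of
`L = (x,…,c) ++ (a,…,b) ++ (d,…,y)`, `{x,a}` is an edge of `G`, and at least
one of `{c,d}`, `{b,y}` is an edge of `G`, then the rearranged ordering
`(d,…,y,b,…,a,x,…,c)` has no more gaps; if both `{c,d}` and `{b,y}` are edges,
it has at least one gap fewer. -/
theorem stmt11 [Fintype V] (G : SimpleGraph V) (hn : 3 ≤ Fintype.card V)
    (X Y Z : List V) (x c a b d y : V)
    (hX : X ≠ []) (hY : Y ≠ []) (hZ : Z ≠ [])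
    (hx : X.head? = some x) (hc : X.getLast? = some c)
    (ha : Y.head? = some a) (hb : Y.getLast? = some b)
    (hd : Z.head? = some d) (hy : Z.getLast? = some y)
    (hL : IsCircleOrdering (X ++ Y ++ Z))
    (hgap : s(y, x) ∉ G.edgeSet)
    (hedge : s(x, a) ∈ G.edgeSet)
    (hor : s(c, d) ∈ G.edgeSet ∨ s(b, y) ∈ G.edgeSet) :
    numGaps G (Z ++ Y.reverse ++ X) ≤ numGaps G (X ++ Y ++ Z) ∧
      (s(c, d) ∈ G.edgeSet → s(b, y) ∈ G.edgeSet →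
        numGaps G (Z ++ Y.reverse ++ X) + 1 ≤ numGaps G (X ++ Y ++ Z)) := by
  have hrev := (pathPairs_reverse_perm Y).countP_eq
    (fun e => @decide (e ∉ G.edgeSet) (Classical.propDecidable _))
  have hyb : s(y, b) = s(b, y) := Sym2.eq_swap
  have hax : s(a, x) = s(x, a) := Sym2.eq_swap
  unfold numGaps
  rw [adjPairs_append_three hx hc ha hb hd hy,
    adjPairs_append_three (a := b) (b := a) hd hy (by simp [hb]) (by simp [ha]) hx hc,
    hyb, hax]
  simp only [List.countP_append, List.countP_cons, List.countP_nil, hrev]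
  constructor
  · rcases hor with h | h <;> simp [hgap, hedge, h] <;> split_ifs <;> omega
  · intro h h'
    simp [hgap, hedge, h, h']
    omega
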